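/- Every positive integer n ≡ 1 (mod 8) can be written as a sum of three or fewer squares; more precisely, writing n = 8m + 1, if m = t_x + 4t_y + z² + (z+1)² then n = (2x+1)² + 4(2y+1)² + 4(2z+1)²; if m = t_x + 2y² + 2z² then n = (2x+1)² + (4y)² + (4z)²; and if m = t_x + 2y² then n = (2x+1)² + (4y)². -/

import Mathlib

/-- The `k`-th triangular number. -/
def triangular (k : ℕ) : ℕ := k * (k + 1) / 2

/-- Twice the `k`-th triangular number is `k (k + 1)`. -/
theorem two_mul_triangular (k : ℕ) : 2 * triangular k = k * (k + 1) :=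
  Nat.mul_div_cancel' (Nat.even_mul_succ_self k).two_dvd

/-- Every integer is congruent modulo `a > 0` to one of absolute value at most `a / 2`. -/
theorem exists_add_mul_abs_le (a f : ℤ) (ha : 0 < a) :
    ∃ k : ℤ, -a ≤ 2 * (f + k * a) ∧ 2 * (f + k * a) ≤ a := by
  have h1 := Int.mul_ediv_add_emod (2 * f + a) (2 * a)
  have h2 := Int.emod_nonneg (2 * f + a) (b := 2 * a) (by lia)
  have h3 := Int.emod_lt_of_pos (2 * f + a) (b := 2 * a) (by lia)
  exact ⟨-((2 * f + a) / (2 * a)), by linarith, by linarith⟩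

/-- Gauss reduction: a positive definite binary form of determinant `D` has a basis whose first
vector has norm at most `√(4 D / 3)`. -/
theorem exists_binary_reduced (D a b c : ℤ) (ha : 0 < a) (hD : 0 < D) (hdet : a * c - b ^ 2 = D) :
    ∃ p q r s : ℤ, p * s - q * r = 1 ∧ 0 < a * p ^ 2 + 2 * b * p * r + c * r ^ 2 ∧
      3 * (a * p ^ 2 + 2 * b * p * r + c * r ^ 2) ^ 2 ≤ 4 * D := by
  induction h : a.toNat using Nat.strong_induction_on generalizing a b c with
  | _ n ih =>
    by_cases hle : 3 * a ^ 2 ≤ 4 * D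
    · exact ⟨1, 0, 0, 1, by norm_num, by simpa using ha, by simpa using hle⟩
    · obtain ⟨k, hk1, hk2⟩ := exists_add_mul_abs_le a b ha
      have hdet' : a * (c + 2 * k * b + a * k ^ 2) - (b + k * a) ^ 2 = D := by
        linear_combination hdet
      generalize hb : b + k * a = b' at *
      generalize hc : c + 2 * k * b + a * k ^ 2 = c' at *
      have hlt : c' < a := by nlinarith
      have hpos : 0 < c' := by nlinarith [sq_nonneg b']
      obtain ⟨p, q, r, s, h1, h2, h3⟩ := ih c'.toNat (by lia) c' (-b') a hpos
        (by linear_combination hdet') rfl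
      have key : a * (k * p - r) ^ 2 + 2 * b * (k * p - r) * p + c * p ^ 2 =
          c' * p ^ 2 + 2 * -b' * p * r + a * r ^ 2 := by
        rw [← hb, ← hc]; ring
      exact ⟨k * p - r, k * q - s, p, q, by linear_combination h1, by rwa [key], by rwa [key]⟩

/-- A positive definite binary form of determinant one represents only sums of two squares. -/
theorem binary_unimodular_sum_two_squares (a b c : ℤ) (ha : 0 < a) (hdet : a * c - b ^ 2 = 1)
    (y z : ℤ) : ∃ u v : ℤ, a * y ^ 2 + 2 * b * y * z + c * z ^ 2 = u ^ 2 + v ^ 2 := by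
  obtain ⟨p, q, r, s, h1, h2, h3⟩ := exists_binary_reduced 1 a b c ha one_pos hdet
  have hg : a * p ^ 2 + 2 * b * p * r + c * r ^ 2 = 1 := by nlinarith
  -- In the basis `(p, r), (q, s)` the form is `(Y + m Z) ^ 2 + Z ^ 2`.
  refine ⟨(s * y - q * z) + (a * p * q + b * (p * s + q * r) + c * r * s) * (-r * y + p * z),
    -r * y + p * z, ?_⟩
  generalize hY : s * y - q * z = Y
  generalize hZ : -r * y + p * z = Z
  have hy : y = p * Y + q * Z := by rw [← hY, ← hZ]; linear_combination (-y) * h1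
  have hz : z = r * Y + s * Z := by rw [← hY, ← hZ]; linear_combination (-z) * h1
  have hdet' : (a * p ^ 2 + 2 * b * p * r + c * r ^ 2) * (a * q ^ 2 + 2 * b * q * s + c * s ^ 2) -
      (a * p * q + b * (p * s + q * r) + c * r * s) ^ 2 = 1 := by
    linear_combination (p * s - q * r) ^ 2 * hdet + (p * s - q * r + 1) * h1
  rw [hg] at hdet'
  rw [hy, hz]
  linear_combination Y ^ 2 * hg + Z ^ 2 * hdet'

/-- The ternary quadratic form with Gram matrix `!![a, f, e; f, b, d; e, d, c]`. -/
def ternaryForm (a b c d e f x y z : ℤ) : ℤ :=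
  a * x ^ 2 + b * y ^ 2 + c * z ^ 2 + 2 * d * y * z + 2 * e * x * z + 2 * f * x * y

/-- A positive definite ternary form of determinant one represents only sums of three squares. -/
theorem ternary_unimodular_sum_three_squares (a b c d e f : ℤ) (ha : 0 < a)
    (hab : 0 < a * b - f ^ 2)
    (hdet : a * b * c + 2 * d * e * f - a * d ^ 2 - b * e ^ 2 - c * f ^ 2 = 1) (x y z : ℤ) :
    ∃ u v w : ℤ, ternaryForm a b c d e f x y z = u ^ 2 + v ^ 2 + w ^ 2 := by
  induction h : a.toNat using Nat.strong_induction_on generalizing a b c d e f x y z with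
  | _ n ih =>
    have hG : (a * b - f ^ 2) * (a * c - e ^ 2) - (a * d - e * f) ^ 2 = a := by
      linear_combination a * hdet
    by_cases ha1 : a = 1
    · subst ha1
      obtain ⟨v, w, hvw⟩ := binary_unimodular_sum_two_squares _ _ _ hab hG y z
      exact ⟨x + f * y + e * z, v, w, by rw [ternaryForm]; linear_combination hvw⟩
    · obtain ⟨p, q, r, s, h1, h2, h3⟩ := exists_binary_reduced a _ _ _ hab ha hG
      obtain ⟨k, hk1, hk2⟩ := exists_add_mul_abs_le a (f * p + e * r) ha
      have hminor : a * (ternaryForm a b c d e f k p r) - (f * p + e * r + k * a) ^ 2 =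
          (a * b - f ^ 2) * p ^ 2 + 2 * (a * d - e * f) * p * r + (a * c - e ^ 2) * r ^ 2 := by
        rw [ternaryForm]; ring
      generalize hg : (a * b - f ^ 2) * p ^ 2 + 2 * (a * d - e * f) * p * r +
        (a * c - e ^ 2) * r ^ 2 = g at *
      have hdet' : a * ternaryForm a b c d e f k p r * ternaryForm a b c d e f 0 q s +
          2 * (b * p * q + d * (p * s + q * r) + c * r * s + k * (f * q + e * s)) *
            (f * q + e * s) * (f * p + e * r + k * a) -
          a * (b * p * q + d * (p * s + q * r) + c * r * s + k * (f * q + e * s)) ^ 2 -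
          ternaryForm a b c d e f k p r * (f * q + e * s) ^ 2 -
          ternaryForm a b c d e f 0 q s * (f * p + e * r + k * a) ^ 2 = 1 := by
        simp only [ternaryForm]
        linear_combination (p * s - q * r) ^ 2 * hdet + (p * s - q * r + 1) * h1
      have hval : ternaryForm a b c d e f x y z =
          ternaryForm (ternaryForm a b c d e f k p r) a (ternaryForm a b c d e f 0 q s)
            (f * q + e * s) (b * p * q + d * (p * s + q * r) + c * r * s + k * (f * q + e * s))
            (f * p + e * r + k * a)
            (s * y - q * z) (x - k * (s * y - q * z)) (-r * y + p * z) := by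
        generalize hY : s * y - q * z = Y
        generalize hZ : -r * y + p * z = Z
        have hy : y = p * Y + q * Z := by rw [← hY, ← hZ]; linear_combination (-y) * h1
        have hz : z = r * Y + s * Z := by rw [← hY, ← hZ]; linear_combination (-z) * h1
        rw [hy, hz]
        simp only [ternaryForm]
        ring
      rw [hval]
      generalize ternaryForm a b c d e f k p r = b' at *
      generalize f * p + e * r + k * a = f' at *
      have hpos : 0 < b' := by nlinarith [sq_nonneg f']
      have hlt : b' < a := by
        by_contra! hge
        have h4 : 3 * a ^ 2 ≤ 4 * g := by nlinarith
        have h5 := pow_le_pow_left₀ (by positivity) h4 2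
        have ha2 : (2 : ℤ) ≤ a := by lia
        have h6 := mul_le_mul_of_nonneg_left (pow_le_pow_left₀ (by norm_num) ha2 3) ha.le
        ring_nf at h3 h5 h6
        linarith
      exact ih b'.toNat (by lia) b' a _ _ _ f' hpos (by linarith)
        (by linear_combination hdet') _ _ _ rfl

/-- If `2 p = b n - 1` with `b ≡ 3 (mod 8)` and `p ≡ 1 (mod 4)` prime, then `-b` is a square
modulo `2 p`. -/
theorem exists_two_mul_prime_dvd_sq_add (n b p : ℕ) (hp : p.Prime) (hp4 : p % 4 = 1)
    (hb : b % 8 = 3) (h : 2 * p + 1 = b * n) : ∃ x : ℤ, (2 * p : ℤ) ∣ x ^ 2 + b := by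
  have := Fact.mk hp
  have hbo : Odd b := Nat.odd_iff.2 (by lia)
  have hpo : Odd p := Nat.odd_iff.2 (by lia)
  have hneg : jacobiSym (-1) b = -1 := by
    rw [jacobiSym.at_neg_one hbo, ZMod.χ₄_nat_three_mod_four (by lia)]
  have htwo : jacobiSym 2 b = -1 := by
    rw [jacobiSym.at_two hbo, ZMod.χ₈_nat_eq_if_mod_eight]
    simp [hb]; lia
  have hmod : jacobiSym (2 * p) b = jacobiSym (-1) b := by
    apply jacobiSym.mod_left'
    refine (Int.emod_emod_of_dvd _ dvd_rfl).symm.trans ?_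
    rw [show (2 * p : ℤ) = -1 + b * n by have : (2 * p + 1 : ℤ) = b * n := by exact_mod_cast h
                                         linarith]
    simp
  have hpb : jacobiSym p b = 1 := by
    rw [jacobiSym.mul_left, htwo, hneg] at hmod
    lia
  have hbp : jacobiSym (-b) p = 1 := by
    rw [jacobiSym.neg _ hpo, ZMod.χ₄_nat_one_mod_four hp4, one_mul,
      ← jacobiSym.quadratic_reciprocity_one_mod_four hp4 hbo, hpb]
  rw [← jacobiSym.legendreSym.to_jacobiSym] at hbp
  have hne : ((-b : ℤ) : ZMod p) ≠ 0 := by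
    intro h0
    rw [(legendreSym.eq_zero_iff p _).2 h0] at hbp
    exact zero_ne_one hbp
  obtain ⟨t, ht⟩ := (legendreSym.eq_one_iff p hne).1 hbp
  obtain ⟨x, rfl⟩ := ZMod.intCast_surjective t
  have hdvd : (p : ℤ) ∣ x ^ 2 + b := by
    rw [← ZMod.intCast_zmod_eq_zero_iff_dvd]
    push_cast at ht ⊢
    linear_combination -ht
  have hcop : IsCoprime (2 : ℤ) p := by
    exact_mod_cast Nat.isCoprime_iff_coprime.2 (Nat.coprime_two_left.2 hpo)
  have hbo' : Odd (b : ℤ) := by exact_mod_cast hbo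
  have hpo' : Odd (p : ℤ) := by exact_mod_cast hpo
  rcases Int.even_or_odd x with hx | hx
  · refine ⟨x + p, hcop.mul_dvd ((hx.add_odd hpo').pow.add_odd hbo').two_dvd ?_⟩
    rw [show (x + p) ^ 2 + (b : ℤ) = (x ^ 2 + b) + p * (2 * x + p) by ring]
    exact dvd_add hdvd (dvd_mul_right _ _)
  · exact ⟨x, hcop.mul_dvd (hx.pow.add_odd hbo').two_dvd hdvd⟩

/-- For `n ≡ 1 (mod 8)` there are `b ≡ 3 (mod 8)` and a prime `p ≡ 1 (mod 4)` with
`2 p = b n - 1`. -/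
theorem exists_prime_two_mul_add_one_eq_mul (n : ℕ) (hn : n % 8 = 1) :
    ∃ b p : ℕ, p.Prime ∧ p % 4 = 1 ∧ b % 8 = 3 ∧ 2 * p + 1 = b * n := by
  obtain ⟨c, hc⟩ : ∃ c, 2 * c + 1 = 3 * n := ⟨(3 * n - 1) / 2, by lia⟩
  have hcop : c.Coprime (4 * n) := by
    refine Nat.Coprime.mul_right ?_ ?_
    · exact Nat.Coprime.pow_right 2 (Nat.coprime_two_right.2 (Nat.odd_iff.2 (by lia)))
    · rw [← Nat.isCoprime_iff_coprime]
      exact ⟨-2, 3, by have : (2 * c + 1 : ℤ) = 3 * n := by exact_mod_cast hc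
                       linarith⟩
  obtain ⟨p, hpc, hp, hmod⟩ :=
    Nat.forall_exists_prime_gt_and_modEq c (by lia : 4 * n ≠ 0) hcop
  obtain ⟨j, hj⟩ := (Nat.modEq_iff_dvd' hpc.le).1 hmod.symm
  have hpj : p = c + 4 * (n * j) := by rw [← mul_assoc, ← hj]; lia
  exact ⟨8 * j + 3, p, hp, by lia, by lia, by rw [hpj]; linarith⟩

/-- Every positive integer `n ≡ 1 (mod 8)` is a sum of three or fewer squares,
via explicit identities for `n = 8m + 1`. -/
theorem sum_three_squares_of_mod_eight_one :
    (∀ m x y z : ℕ, m = triangular x + 4 * triangular y + z ^ 2 + (z + 1) ^ 2 →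
        8 * m + 1 = (2 * x + 1) ^ 2 + 4 * (2 * y + 1) ^ 2 + 4 * (2 * z + 1) ^ 2) ∧
      (∀ m x y z : ℕ, m = triangular x + 2 * y ^ 2 + 2 * z ^ 2 →
        8 * m + 1 = (2 * x + 1) ^ 2 + (4 * y) ^ 2 + (4 * z) ^ 2) ∧
      (∀ m x y : ℕ, m = triangular x + 2 * y ^ 2 →
        8 * m + 1 = (2 * x + 1) ^ 2 + (4 * y) ^ 2) ∧
      (∀ n : ℕ, 0 < n → n % 8 = 1 → ∃ x y z : ℕ, n = x ^ 2 + y ^ 2 + z ^ 2) := by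
  refine ⟨?_, ?_, ?_, ?_⟩
  · rintro m x y z rfl
    linarith [two_mul_triangular x, two_mul_triangular y]
  · rintro m x y z rfl
    linarith [two_mul_triangular x]
  · rintro m x y rfl
    linarith [two_mul_triangular x]
  · intro n _ hn
    obtain ⟨b, p, hp, hp4, hb, h⟩ := exists_prime_two_mul_add_one_eq_mul n hn
    obtain ⟨x, a, hx⟩ := exists_two_mul_prime_dvd_sq_add n b p hp hp4 hb h
    have hz : (2 * p + 1 : ℤ) = b * n := by exact_mod_cast h
    have hp0 : (0 : ℤ) < p := by exact_mod_cast hp.pos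
    have hb0 : (0 : ℤ) < b := by lia
    obtain ⟨u, v, w, huvw⟩ := ternary_unimodular_sum_three_squares (2 * p) a n 1 0 x
      (by linarith) (by linarith) (by linear_combination -n * hx - hz) 0 0 1
    refine ⟨u.natAbs, v.natAbs, w.natAbs, ?_⟩
    zify
    simp only [sq_abs]
    rw [← huvw, ternaryForm]
    ring
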